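/- Suppose the decision-theoretic kernel p(W_V | F_A) obeys distributional consistency and the augmented DAG local Markov property with respect to 𝒢̄*, where 𝒢̄ is the complete DAG on V under a total order ≺ (so pa_𝒢̄(i) = pre(i) for all i). Suppose further that the observational distribution p(W_V | F_A = ∅) is strictly positive and obeys the ordinary ordered local Markov property with respect to a subgraph 𝒢 of 𝒢̄ (with parent sets pa_𝒢(i) ⊆ pre(i)) and ≺. Then the kernel also obeys the augmented DAG local Markov property for 𝒢*: for every i ∈ V, every fully non-idle regime a ∈ 𝔛_A, and every w ∈ 𝔛_{pre(i)} with positive probability, the conditional distribution p(W_i = · | W_{pre(i)} = w, F_A = a) is a function only of a_{pa_𝒢(i)∩A} and w_{pa_𝒢(i)∖A}. -/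

import Mathlib

open Finset

namespace CausalPaper

variable {V : Type*} [Fintype V] [LinearOrder V]
variable {𝔛 : V → Type*} [∀ i, Fintype (𝔛 i)]

/-- Probability of the event `E` under the distribution `q` on joint assignments. -/
noncomputable def pr (q : (∀ i, 𝔛 i) → ℝ) (E : (∀ i, 𝔛 i) → Prop) : ℝ :=
  ∑ v : (∀ i, 𝔛 i), Set.indicator (setOf E) q v

/-- Conditional probability of `E` given `F` under `q`. -/
noncomputable def cpr (q : (∀ i, 𝔛 i) → ℝ) (E F : (∀ i, 𝔛 i) → Prop) : ℝ :=
  pr q (fun v => E v ∧ F v) / pr q F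

/-- `q` is a probability distribution on joint assignments. -/
def IsProb (q : (∀ i, 𝔛 i) → ℝ) : Prop :=
  (∀ v, 0 ≤ q v) ∧ (∑ v : (∀ i, 𝔛 i), q v) = 1

/-- `v` agrees with `s` on the coordinates in `S`. -/
def agree (S : Finset V) (s v : ∀ i, 𝔛 i) : Prop :=
  ∀ i ∈ S, v i = s i

/-- The intervention/regime that sets the variables in `B` according to `b`
(and is idle elsewhere). -/
def setOn (B : Finset V) (b : ∀ i, 𝔛 i) : ∀ i, Option (𝔛 i) :=
  fun i => if i ∈ B then some (b i) else none

/-- The support of the partial intervention/regime `f` is contained in `A`. -/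
def suppIn (f : ∀ i, Option (𝔛 i)) (A : Finset V) : Prop :=
  ∀ i, f i ≠ none → i ∈ A

/-- Distributional consistency. -/
def DistConsistent (A : Finset V) (P : (∀ i, Option (𝔛 i)) → (∀ i, 𝔛 i) → ℝ) : Prop :=
  ∀ i ∈ A, ∀ C : Finset V, C ⊆ A \ {i} →
    ∀ (y : ∀ j, 𝔛 j) (b : 𝔛 i) (c : ∀ j, 𝔛 j),
      pr (P (Function.update (setOn C c) i (some b)))
          (fun v => agree (univ \ {i}) y v ∧ v i = b)
        = pr (P (setOn C c)) (fun v => agree (univ \ {i}) y v ∧ v i = b)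

/-- The predecessors of `i` under the total order on `V`. -/
def pre (i : V) : Finset V := univ.filter (fun j => j < i)

/-- The (SWIG / augmented-DAG) ordered local Markov property: under the regime
intervening on all of `A`, the conditional distribution of `X_i` given its
predecessors is a function only of `a` on `pa i ∩ A` and of `w` on `pa i \ A`. -/
def AugmentedLocalMarkov (A : Finset V) (pa : V → Finset V)
    (P : (∀ i, Option (𝔛 i)) → (∀ i, 𝔛 i) → ℝ) : Prop :=
  ∀ (i : V) (a a' w w' : ∀ j, 𝔛 j) (x : 𝔛 i),
    0 < pr (P (setOn A a)) (agree (pre i) w) →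
    0 < pr (P (setOn A a')) (agree (pre i) w') →
    (∀ j ∈ pa i ∩ A, a j = a' j) →
    (∀ j ∈ pa i \ A, w j = w' j) →
    cpr (P (setOn A a)) (fun v => v i = x) (agree (pre i) w)
      = cpr (P (setOn A a')) (fun v => v i = x) (agree (pre i) w')

/-- The ordinary ordered local Markov property for a single distribution `q`:
the conditional distribution of `X_i` given its predecessors is a function only
of the values of the parents. -/
def OrderedLocalMarkov (pa : V → Finset V) (q : (∀ i, 𝔛 i) → ℝ) : Prop :=
  ∀ (i : V) (w w' : ∀ j, 𝔛 j) (x : 𝔛 i),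
    0 < pr q (agree (pre i) w) →
    0 < pr q (agree (pre i) w') →
    (∀ j ∈ pa i, w j = w' j) →
    cpr q (fun v => v i = x) (agree (pre i) w)
      = cpr q (fun v => v i = x) (agree (pre i) w')

set_option linter.unusedSectionVars false

section Pr

lemma pr_nonneg {q : (∀ i, 𝔛 i) → ℝ} (hq : ∀ v, 0 ≤ q v) (E : (∀ i, 𝔛 i) → Prop) :
    0 ≤ pr q E :=
  Finset.sum_nonneg fun v _ => Set.indicator_nonneg (fun v _ => hq v) v

lemma pr_mono {q : (∀ i, 𝔛 i) → ℝ} (hq : ∀ v, 0 ≤ q v) {E F : (∀ i, 𝔛 i) → Prop}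
    (h : ∀ v, E v → F v) : pr q E ≤ pr q F :=
  Finset.sum_le_sum fun v _ =>
    Set.indicator_le_indicator_of_subset (fun v => h v) (fun v => hq v) v

lemma pr_of_forall_iff_eq (q : (∀ i, 𝔛 i) → ℝ) {E : (∀ i, 𝔛 i) → Prop} (w : ∀ i, 𝔛 i)
    (h : ∀ v, E v ↔ v = w) : pr q E = q w := by
  unfold pr
  rw [Finset.sum_eq_single w]
  · exact Set.indicator_of_mem (show E w from (h w).2 rfl) q
  · intro v _ hv
    exact Set.indicator_of_notMem (fun hE => hv ((h v).1 hE)) q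
  · intro hw
    exact absurd (Finset.mem_univ w) hw

lemma le_pr {q : (∀ i, 𝔛 i) → ℝ} (hq : ∀ v, 0 ≤ q v) {E : (∀ i, 𝔛 i) → Prop}
    {w : ∀ i, 𝔛 i} (hw : E w) : q w ≤ pr q E := by
  rw [← pr_of_forall_iff_eq q (E := fun v => v = w) w fun _ => Iff.rfl]
  exact pr_mono hq fun v hv => hv ▸ hw

lemma pr_eq_sum_pr_and (q : (∀ i, 𝔛 i) → ℝ) (E : (∀ i, 𝔛 i) → Prop) (i : V) :
    pr q E = ∑ x : 𝔛 i, pr q (fun v => v i = x ∧ E v) := by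
  unfold pr
  rw [Finset.sum_comm]
  refine Finset.sum_congr rfl fun v _ => ?_
  rw [Finset.sum_eq_single (v i)]
  · refine Set.indicator_eq_indicator ?_ rfl
    exact ⟨fun h => ⟨rfl, h⟩, fun h => h.2⟩
  · intro x _ hx
    exact Set.indicator_of_notMem (fun h => hx h.1.symm) q
  · intro h
    exact absurd (Finset.mem_univ _) h

lemma agree_insert_update {S : Finset V} {i : V} (hi : i ∉ S) (w : ∀ j, 𝔛 j) (x : 𝔛 i)
    (v : ∀ j, 𝔛 j) :
    (v i = x ∧ agree S w v) ↔ agree (insert i S) (Function.update w i x) v := by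
  have hne : ∀ j ∈ S, j ≠ i := fun j hj h => hi (h ▸ hj)
  simp only [agree, Finset.mem_insert, forall_eq_or_imp, Function.update_self]
  refine and_congr_right fun _ => forall₂_congr fun j hj => ?_
  rw [Function.update_of_ne (hne j hj)]

lemma agree_univ_iff (w v : ∀ j, 𝔛 j) : agree univ w v ↔ v = w := by
  simp [agree, funext_iff]

end Pr

section Order

lemma mem_pre {i j : V} : j ∈ pre i ↔ j < i := by simp [pre]

lemma notMem_pre_self (i : V) : i ∉ pre i := by simp [pre]

lemma pre_induction {p : Finset V → Prop} (h0 : p ∅)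
    (hs : ∀ i, p (pre i) → p (insert i (pre i))) (i : V) : p (pre i) := by
  induction i using WellFoundedLT.induction with
  | ind i ih =>
    rcases (pre i).eq_empty_or_nonempty with h | h
    · rwa [h]
    · have hm := mem_pre.1 ((pre i).max'_mem h)
      have heq : pre i = insert ((pre i).max' h) (pre ((pre i).max' h)) := by
        ext j
        rw [Finset.mem_insert, mem_pre, mem_pre, ← le_iff_eq_or_lt]
        exact ⟨fun hj => (pre i).le_max' j (mem_pre.2 hj), fun hj => hj.trans_lt hm⟩
      rw [heq]
      exact hs _ (ih _ hm)

lemma insert_pre_induction {p : Finset V → Prop} (h1 : p univ)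
    (hs : ∀ i, p (insert i (pre i)) → p (pre i)) (i : V) : p (insert i (pre i)) := by
  induction i using WellFoundedGT.induction with
  | ind i ih =>
    rcases (univ.filter (i < ·)).eq_empty_or_nonempty with h | h
    · convert h1
      ext j
      have hj : j ∉ univ.filter (i < ·) := by simp [h]
      simpa [mem_pre, ← le_iff_eq_or_lt] using hj
    · have hm : i < (univ.filter (i < ·)).min' h := by
        simp
      have heq : insert i (pre i) = pre ((univ.filter (i < ·)).min' h) := by
        ext j
        rw [Finset.mem_insert, mem_pre, mem_pre, ← le_iff_eq_or_lt]
        refine ⟨fun hj => hj.trans_lt hm, fun hj => ?_⟩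
        by_contra hij
        exact hj.not_ge (Finset.min'_le _ j (by simpa using hij))
      rw [heq]
      exact hs _ (ih _ hm)

end Order

section Kernel

variable {A : Finset V} {P : (∀ i, Option (𝔛 i)) → (∀ i, 𝔛 i) → ℝ}

lemma suppIn_setOn (A : Finset V) (a : ∀ i, 𝔛 i) : suppIn (setOn A a) A := by
  intro i hi
  by_contra h
  simp [setOn, h] at hi

lemma setOn_congr {a a' : ∀ i, 𝔛 i} (h : ∀ i ∈ A, a i = a' i) : setOn A a = setOn A a' := by
  funext i
  by_cases hi : i ∈ A
  · simp [setOn, hi, h i hi]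
  · simp [setOn, hi]

/-- Intervening on variables to the values they take does not change the probability. -/
lemma DistConsistent.apply_setOn_self (hDC : DistConsistent A P) (v : ∀ i, 𝔛 i)
    {C : Finset V} (hC : C ⊆ A) : P (setOn C v) v = P (fun _ => none) v := by
  induction C using Finset.induction_on with
  | empty =>
    rw [show setOn ∅ v = fun _ => none from funext fun i => by simp [setOn]]
  | insert i C hi ih =>
    have hset : setOn (insert i C) v = Function.update (setOn C v) i (some (v i)) := by
      funext j
      rcases eq_or_ne j i with rfl | hj
      · simp [setOn]
      · simp [setOn, hj]
    have hE : ∀ u : ∀ j, 𝔛 j, (agree (univ \ {i}) v u ∧ u i = v i) ↔ u = v := by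
      intro u
      refine ⟨fun h => funext fun j => ?_, fun h => by subst h; exact ⟨fun _ _ => rfl, rfl⟩⟩
      rcases eq_or_ne j i with rfl | hj
      · exact h.2
      · exact h.1 j (by simp [hj])
    have hCA : C ⊆ A \ {i} := fun j hj =>
      Finset.mem_sdiff.2 ⟨hC (Finset.mem_insert_of_mem hj), by
        rw [Finset.mem_singleton]; rintro rfl; exact hi hj⟩
    have key := hDC i (hC (Finset.mem_insert_self i C)) C hCA v (v i) v
    rw [pr_of_forall_iff_eq _ v hE, pr_of_forall_iff_eq _ v hE] at key
    rw [hset, key]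
    exact ih ((Finset.subset_insert i C).trans hC)

/-- One step of the chain rule along the order. -/
lemma AugmentedLocalMarkov.pr_and_eq_of_pr_eq
    (hP : ∀ f, suppIn f A → IsProb (P f))
    (hM : AugmentedLocalMarkov A (fun i => pre i) P) {i : V} {a a' : ∀ j, 𝔛 j}
    (haa : ∀ j ∈ pre i ∩ A, a j = a' j) (w : ∀ j, 𝔛 j) (x : 𝔛 i)
    (h : pr (P (setOn A a)) (agree (pre i) w) = pr (P (setOn A a')) (agree (pre i) w)) :
    pr (P (setOn A a)) (fun v => v i = x ∧ agree (pre i) w v)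
      = pr (P (setOn A a')) (fun v => v i = x ∧ agree (pre i) w v) := by
  have hn := (hP _ (suppIn_setOn A a)).1
  have hn' := (hP _ (suppIn_setOn A a')).1
  rcases (pr_nonneg hn (agree (pre i) w)).eq_or_lt with h0 | h0
  · have h1 := pr_mono hn (E := fun v => v i = x ∧ agree (pre i) w v) fun _ hv => hv.2
    have h1' := pr_mono hn' (E := fun v => v i = x ∧ agree (pre i) w v) fun _ hv => hv.2
    rw [← h0] at h1
    rw [← h, ← h0] at h1'
    rw [h1.antisymm (pr_nonneg hn _), h1'.antisymm (pr_nonneg hn' _)]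
  · have key := hM i a a' w w x h0 (h ▸ h0) haa fun _ _ => rfl
    unfold cpr at key
    rw [← h] at key
    exact (div_left_inj' h0.ne').1 key

lemma AugmentedLocalMarkov.pr_agree_pre_eq
    (hP : ∀ f, suppIn f A → IsProb (P f))
    (hM : AugmentedLocalMarkov A (fun i => pre i) P) {i : V} {a a' : ∀ j, 𝔛 j}
    (haa : ∀ j ∈ pre i ∩ A, a j = a' j) (w : ∀ j, 𝔛 j) :
    pr (P (setOn A a)) (agree (pre i) w) = pr (P (setOn A a')) (agree (pre i) w) := by
  revert a a' w
  refine pre_induction (p := fun S => ∀ {a a' : ∀ j, 𝔛 j}, (∀ j ∈ S ∩ A, a j = a' j) →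
    ∀ w, pr (P (setOn A a)) (agree S w) = pr (P (setOn A a')) (agree S w)) ?_ ?_ i
  · intro a a' _ w
    have h1 : ∀ q : (∀ j, 𝔛 j) → ℝ, IsProb q → pr q (agree ∅ w) = 1 := by
      intro q hq
      rw [← hq.2]
      exact Finset.sum_congr rfl fun v _ =>
        Set.indicator_of_mem (show agree ∅ w v by simp [agree]) q
    rw [h1 _ (hP _ (suppIn_setOn A a)), h1 _ (hP _ (suppIn_setOn A a'))]
  · intro i ih a a' haa w
    have haa' : ∀ j ∈ pre i ∩ A, a j = a' j := fun j hj =>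
      haa j (Finset.inter_subset_inter_right (Finset.subset_insert _ _) hj)
    have key := hM.pr_and_eq_of_pr_eq hP haa' w (w i) (ih haa' w)
    simpa only [agree_insert_update (notMem_pre_self i), Function.update_eq_self] using key

lemma AugmentedLocalMarkov.pr_agree_insert_pre_eq
    (hP : ∀ f, suppIn f A → IsProb (P f))
    (hM : AugmentedLocalMarkov A (fun i => pre i) P) {i : V} {a a' : ∀ j, 𝔛 j}
    (haa : ∀ j ∈ pre i ∩ A, a j = a' j) (w : ∀ j, 𝔛 j) :
    pr (P (setOn A a)) (agree (insert i (pre i)) w)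
      = pr (P (setOn A a')) (agree (insert i (pre i)) w) := by
  have key := hM.pr_and_eq_of_pr_eq hP haa w (w i) (hM.pr_agree_pre_eq hP haa w)
  simpa only [agree_insert_update (notMem_pre_self i), Function.update_eq_self] using key

lemma pr_agree_pre_setOn_self_of_insert
    (hP : ∀ f, suppIn f A → IsProb (P f))
    (hM : AugmentedLocalMarkov A (fun i => pre i) P) (i : V)
    (h : ∀ v, pr (P (setOn A v)) (agree (insert i (pre i)) v)
      = pr (P fun _ => none) (agree (insert i (pre i)) v)) (v : ∀ j, 𝔛 j) :
    pr (P (setOn A v)) (agree (pre i) v) = pr (P fun _ => none) (agree (pre i) v) := by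
  rw [pr_eq_sum_pr_and _ _ i, pr_eq_sum_pr_and _ _ i]
  refine Finset.sum_congr rfl fun x _ => ?_
  simp only [agree_insert_update (notMem_pre_self i)]
  rw [← h]
  refine hM.pr_agree_insert_pre_eq hP (fun j hj => ?_) _
  rw [Function.update_of_ne (mem_pre.1 (Finset.mem_inter.1 hj).1).ne]

/-- On an initial segment, the regime setting the targets to the observed values has the
observational probability. -/
lemma pr_agree_insert_pre_setOn_self
    (hP : ∀ f, suppIn f A → IsProb (P f)) (hDC : DistConsistent A P)
    (hM : AugmentedLocalMarkov A (fun i => pre i) P) (i : V) (v : ∀ j, 𝔛 j) :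
    pr (P (setOn A v)) (agree (insert i (pre i)) v)
      = pr (P fun _ => none) (agree (insert i (pre i)) v) := by
  revert v
  refine insert_pre_induction (p := fun S => ∀ v, pr (P (setOn A v)) (agree S v)
    = pr (P fun _ => none) (agree S v)) (fun v => ?_)
    (pr_agree_pre_setOn_self_of_insert hP hM) i
  rw [pr_of_forall_iff_eq _ v (agree_univ_iff v), pr_of_forall_iff_eq _ v (agree_univ_iff v)]
  exact hDC.apply_setOn_self v Subset.rfl

/-- The conditional probabilities under a regime are observational ones, with the targets set
to their intervened values. -/
lemma cpr_setOn_eq_cpr_none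
    (hP : ∀ f, suppIn f A → IsProb (P f)) (hDC : DistConsistent A P)
    (hM : AugmentedLocalMarkov A (fun i => pre i) P)
    (hpos : ∀ v : (∀ j, 𝔛 j), 0 < P (fun _ => none) v)
    (i : V) (a w : ∀ j, 𝔛 j) (x : 𝔛 i)
    (h : 0 < pr (P (setOn A a)) (agree (pre i) w)) :
    cpr (P (setOn A a)) (fun v => v i = x) (agree (pre i) w)
      = cpr (P fun _ => none) (fun v => v i = x) (agree (pre i) (A.piecewise a w)) := by
  set u := A.piecewise a w with hu
  have hset : setOn A u = setOn A a :=
    setOn_congr fun j hj => Finset.piecewise_eq_of_mem _ _ _ hj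
  have hden : pr (P (setOn A a)) (agree (pre i) u) = pr (P fun _ => none) (agree (pre i) u) := by
    rw [← hset]
    exact pr_agree_pre_setOn_self_of_insert hP hM i
      (pr_agree_insert_pre_setOn_self hP hDC hM i) u
  have hupos : 0 < pr (P fun _ => none) (agree (pre i) u) :=
    (hpos u).trans_le (le_pr (fun v => (hpos v).le) fun _ _ => rfl)
  rw [hM i a a w u x h (hden ▸ hupos) (fun _ _ => rfl) fun j hj =>
    (Finset.piecewise_eq_of_notMem _ _ _ (Finset.mem_sdiff.1 hj).2).symm]
  unfold cpr
  rw [hden]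
  simp only [agree_insert_update (notMem_pre_self i)]
  rw [← pr_agree_insert_pre_setOn_self hP hDC hM, ← hset]
  congr 1
  refine hM.pr_agree_insert_pre_eq hP (fun j hj => ?_) _
  rw [Function.update_of_ne (mem_pre.1 (Finset.mem_inter.1 hj).1).ne]

end Kernel

/-- Kernel analogue of the two-graph construction: the augmented-DAG local Markov
property for the complete DAG together with a strictly positive observational
distribution obeying the ordinary local Markov property for a subgraph `𝒢`
implies the augmented-DAG local Markov property for `𝒢*`. -/
theorem stmt18_two_graph_kernel
    (A : Finset V) (hA : A ⊆ univ)
    (pa : V → Finset V) (hpa : ∀ i, pa i ⊆ pre i)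
    (P : (∀ i, Option (𝔛 i)) → (∀ i, 𝔛 i) → ℝ)
    (hP : ∀ f, suppIn f A → IsProb (P f))
    (hDC : DistConsistent A P)
    (hMbar : AugmentedLocalMarkov A (fun i => pre i) P)
    (hpos : ∀ v : (∀ j, 𝔛 j), 0 < P (fun _ => none) v)
    (hObs : OrderedLocalMarkov pa (P (fun _ => none))) :
    AugmentedLocalMarkov A pa P := by
  intro i a a' w w' x hw hw' ha hwa
  have hobs_pos : ∀ u, 0 < pr (P fun _ => none) (agree (pre i) u) := fun u =>
    (hpos u).trans_le (le_pr (fun v => (hpos v).le) fun _ _ => rfl)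
  rw [cpr_setOn_eq_cpr_none hP hDC hMbar hpos i a w x hw,
    cpr_setOn_eq_cpr_none hP hDC hMbar hpos i a' w' x hw']
  refine hObs i _ _ x (hobs_pos _) (hobs_pos _) fun j hj => ?_
  by_cases hjA : j ∈ A
  · simpa [hjA] using ha j (Finset.mem_inter.2 ⟨hj, hjA⟩)
  · simpa [hjA] using hwa j (Finset.mem_sdiff.2 ⟨hj, hjA⟩)

end CausalPaper
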